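/- Let G be a path graph with n vertices, and let A, B ⊆ V(G) with m(A) = m(B), each having k connected components. Suppose b(A, k) = n − |A| − k ≥ min{x, y} for every inversion (x_i, y_j) ∈ inv(h'_A, h'_B). Then there exists a reconfiguration sequence from A to B under the component jumping rule CJ whose length is O(n²); more precisely, of length at most c·n² for an absolute constant c. -/

import Mathlib

open scoped Classical

noncomputable section

/-- `U` induces a connected subgraph of `G`. -/
def IsConnSub {V : Type*} (G : SimpleGraph V) (U : Finset V) : Prop :=
  (G.induce (U : Set V)).Connected

/-- The set of connected components of a vertex subset `U`:
maximal subsets of `U` inducing connected subgraphs. -/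
def comps {V : Type*} [Fintype V] [DecidableEq V] (G : SimpleGraph V) (U : Finset V) :
    Finset (Finset V) :=
  Finset.univ.filter (fun C => C ⊆ U ∧ IsConnSub G C ∧
    ∀ D : Finset V, C ⊆ D → D ⊆ U → IsConnSub G D → D = C)

/-- The CC-multiset of `U`: the multiset of sizes of connected components of `U`. -/
def ccMultiset {V : Type*} [Fintype V] [DecidableEq V] (G : SimpleGraph V) (U : Finset V) :
    Multiset ℕ :=
  (comps G U).val.map Finset.card

/-- Adjacency under component jumping (CJ). -/
def adjCJ {V : Type*} [Fintype V] [DecidableEq V] (G : SimpleGraph V) (U U' : Finset V) : Prop :=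
  ccMultiset G U = ccMultiset G U' ∧
  (comps G U \ comps G U').card = 1 ∧ (comps G U' \ comps G U).card = 1

/-- Adjacency under component sliding (CS). -/
def adjCS {V : Type*} [Fintype V] [DecidableEq V] (G : SimpleGraph V) (U U' : Finset V) : Prop :=
  adjCJ G U U' ∧
  ∀ C ∈ comps G U \ comps G U', ∀ C' ∈ comps G U' \ comps G U, IsConnSub G (C ∪ C')

/-- Adjacency under CS1 (component sliding by one vertex). -/
def adjCS1 {V : Type*} [Fintype V] [DecidableEq V] (G : SimpleGraph V) (U U' : Finset V) : Prop :=
  adjCS G U U' ∧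
  ∀ C ∈ comps G U \ comps G U', ∀ C' ∈ comps G U' \ comps G U,
    (C \ C').card = 1 ∧ (C' \ C).card = 1

/-- Adjacency under token jumping (TJ). -/
def adjTJ {V : Type*} [DecidableEq V] (G : SimpleGraph V) (U U' : Finset V) : Prop :=
  (U \ U').card = 1 ∧ (U' \ U).card = 1

/-- `A` and `B` are reconfigurable under rule `R` keeping the CC-multiset equal to `M`. -/
def Reconf {V : Type*} [Fintype V] [DecidableEq V] (G : SimpleGraph V) (M : Multiset ℕ)
    (R : Finset V → Finset V → Prop) (A B : Finset V) : Prop :=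
  ∃ (ℓ : ℕ) (W : ℕ → Finset V), W 0 = A ∧ W ℓ = B ∧
    (∀ i ≤ ℓ, ccMultiset G (W i) = M) ∧ ∀ i < ℓ, R (W i) (W (i + 1))

end

/-- `h_U`: the sequence of sizes of connected components of `U` along the path,
listed in left-to-right order (ordering components by their minimum vertex). -/
noncomputable def hseq (n : ℕ) (U : Finset (Fin n)) : List ℕ :=
  (((comps (SimpleGraph.pathGraph n) U).image (fun C => C.min)).sort (· ≤ ·)).map
    (fun m => ((comps (SimpleGraph.pathGraph n) U).filter (fun C => C.min = m)).sup Finset.card)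

/-- The position in `hB` of the subscripted element corresponding to position `p` of `hA`:
the unique index `q` such that `hB` has the same value at `q` as `hA` at `p`, with the same
occurrence count among equal values in the prefix up to and including itself. -/
def matchIdx (hA hB : List ℕ) (p : ℕ) : ℕ :=
  ((List.range hB.length).find? (fun q =>
    decide (hB.getD q 0 = hA.getD p 0 ∧
      (hB.take (q + 1)).count (hA.getD p 0) = (hA.take (p + 1)).count (hA.getD p 0)))).getD 0

/-- `(p, q)` is an inversion between `hA` and `hB`: positions `p < q` in `hA` whose
corresponding subscripted elements appear in the reversed order in `hB`. -/
def IsInv (hA hB : List ℕ) (p q : ℕ) : Prop :=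
  p < q ∧ q < hA.length ∧ matchIdx hA hB q < matchIdx hA hB p

inductive Rch {V : Type*} (R : V → V → Prop) : ℕ → V → V → Prop
  | refl (m : ℕ) (a : V) : Rch R m a a
  | tail {m : ℕ} {a b c : V} : Rch R m a b → R b c → Rch R (m + 1) a c

theorem Rch.mono {V : Type*} {R : V → V → Prop} {m m' : ℕ} {a b : V} (h : Rch R m a b)
    (hm : m ≤ m') : Rch R m' a b := by
  induction h generalizing m' with
  | refl m a => exact Rch.refl _ _
  | tail h1 h2 ih =>
    obtain ⟨k, rfl⟩ : ∃ k, m' = k + 1 := ⟨m' - 1, by omega⟩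
    exact Rch.tail (ih (by omega)) h2

theorem Rch.trans {V : Type*} {R : V → V → Prop} {m m' : ℕ} {a b c : V} (h : Rch R m a b)
    (h' : Rch R m' b c) : Rch R (m + m') a c := by
  induction h' with
  | refl m a => exact h.mono (by omega)
  | tail h1 h2 ih => exact Rch.tail (ih h) h2

theorem Rch.symm {V : Type*} {R : V → V → Prop} (hR : ∀ a b, R a b → R b a) {m : ℕ} {a b : V}
    (h : Rch R m a b) : Rch R m b a := by
  induction h with
  | refl m a => exact Rch.refl _ _
  | tail h1 h2 ih =>
    exact ((Rch.tail (Rch.refl 0 _) (hR _ _ h2)).trans ih).mono (by omega)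

theorem Rch.seq {V : Type*} {R : V → V → Prop} {m : ℕ} {a b : V} (h : Rch R m a b) :
    ∃ (l : ℕ) (W : ℕ → V), W 0 = a ∧ W l = b ∧ (∀ i < l, R (W i) (W (i + 1))) ∧ l ≤ m := by
  induction h with
  | refl m a => exact ⟨0, fun _ => a, rfl, rfl, by simp, by simp⟩
  | @tail m a b c h1 h2 ih =>
    obtain ⟨l, W, h0, hl, hs, hm⟩ := ih
    refine ⟨l + 1, fun i => if i ≤ l then W i else c, by simp [h0], by simp, ?_, by omega⟩
    intro i hi
    by_cases h : i < l
    · have h' : i + 1 ≤ l := h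
      simp only [h.le, h', if_true]
      exact hs i h
    · have : i = l := by omega
      subst this
      simp [hl, h2]

def ivl (n : ℕ) (p : ℕ × ℕ) : Finset (Fin n) :=
  Finset.univ.filter (fun v => p.1 ≤ v.val ∧ v.val < p.1 + p.2)

def US (n : ℕ) (L : List (ℕ × ℕ)) : Finset (Fin n) :=
  Finset.univ.filter (fun v => ∃ p ∈ L, v ∈ ivl n p)

def sepr (p q : ℕ × ℕ) : Prop := p.1 + p.2 < q.1 ∨ q.1 + q.2 < p.1

instance : Std.Symm sepr := ⟨fun _ _ h => Or.symm h⟩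

theorem sepr_symm {p q : ℕ × ℕ} (h : sepr p q) : sepr q p := Or.symm h

def SepL (n : ℕ) (L : List (ℕ × ℕ)) : Prop :=
  (∀ p ∈ L, 1 ≤ p.2 ∧ p.1 + p.2 ≤ n) ∧ L.Pairwise sepr

theorem mem_ivl {n : ℕ} {p : ℕ × ℕ} {v : Fin n} :
    v ∈ ivl n p ↔ p.1 ≤ v.val ∧ v.val < p.1 + p.2 := by simp [ivl]

theorem mem_US {n : ℕ} {L : List (ℕ × ℕ)} {v : Fin n} :
    v ∈ US n L ↔ ∃ p ∈ L, v ∈ ivl n p := by simp [US]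

theorem card_ivl {n : ℕ} {p : ℕ × ℕ} (h : p.1 + p.2 ≤ n) : (ivl n p).card = p.2 := by
  have : (ivl n p).map Fin.valEmbedding = Finset.Ico p.1 (p.1 + p.2) := by
    ext x
    simp only [Finset.mem_map, mem_ivl, Fin.valEmbedding_apply, Finset.mem_Ico]
    constructor
    · rintro ⟨v, hv, rfl⟩; exact hv
    · intro hx; exact ⟨⟨x, by omega⟩, hx, rfl⟩
  rw [← Finset.card_map Fin.valEmbedding, this]; simp

theorem min_ivl {n : ℕ} {p : ℕ × ℕ} (h1 : 1 ≤ p.2) (h : p.1 + p.2 ≤ n) :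
    (ivl n p).min = ((⟨p.1, by omega⟩ : Fin n) : WithTop (Fin n)) := by
  apply le_antisymm
  · apply Finset.min_le
    rw [mem_ivl]; simp; omega
  · apply Finset.le_min
    intro a ha
    rw [mem_ivl] at ha
    exact_mod_cast ha.1

theorem ivl_inj {n : ℕ} {p q : ℕ × ℕ} (h1 : 1 ≤ p.2) (h : p.1 + p.2 ≤ n)
    (h1' : 1 ≤ q.2) (h' : q.1 + q.2 ≤ n) (he : ivl n p = ivl n q) : p = q := by
  have e1 := card_ivl h
  have e2 := card_ivl h'
  have e3 := min_ivl h1 h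
  have e4 := min_ivl h1' h'
  rw [he] at e1 e3
  rw [e3] at e4
  have e5 : p.1 = q.1 := by
    have := WithTop.coe_injective e4
    simpa using this
  exact Prod.ext e5 (by omega)

theorem conn_ivl {n : ℕ} {p : ℕ × ℕ} (h1 : 1 ≤ p.2) (h : p.1 + p.2 ≤ n) :
    IsConnSub (SimpleGraph.pathGraph n) (ivl n p) := by
  unfold IsConnSub
  have h0 : (⟨p.1, by omega⟩ : Fin n) ∈ ((ivl n p : Finset (Fin n)) : Set (Fin n)) := by
    simp only [Finset.mem_coe, mem_ivl]; omega
  have key : ∀ j (hj : j < p.2), ((SimpleGraph.pathGraph n).induce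
      ((ivl n p : Finset (Fin n)) : Set (Fin n))).Reachable ⟨⟨p.1, by omega⟩, h0⟩
      ⟨⟨p.1 + j, by omega⟩, by simp only [Finset.mem_coe, mem_ivl]; omega⟩ := by
    intro j
    induction j with
    | zero => intro hj; exact SimpleGraph.Reachable.refl _
    | succ j ih =>
      intro hj
      refine (ih (by omega)).trans (SimpleGraph.Adj.reachable ?_)
      simp only [SimpleGraph.comap_adj, Function.Embedding.subtype_apply,
        SimpleGraph.pathGraph_adj]
      left; omega
  rw [SimpleGraph.connected_iff_exists_forall_reachable]
  refine ⟨⟨⟨p.1, by omega⟩, h0⟩, ?_⟩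
  rintro ⟨v, hv⟩
  have hv' := hv
  simp only [Finset.mem_coe, mem_ivl] at hv'
  have := key (v.val - p.1) (by omega)
  convert this using 3
  omega

theorem conn_sub {n : ℕ} {L : List (ℕ × ℕ)} (hL : SepL n L) {D : Finset (Fin n)}
    (hD : D ⊆ US n L) (hc : IsConnSub (SimpleGraph.pathGraph n) D) {p : ℕ × ℕ} (hp : p ∈ L)
    {v : Fin n} (hv : v ∈ D) (hvp : v ∈ ivl n p) : D ⊆ ivl n p := by
  intro u hu
  have hr := hc.preconnected ⟨v, hv⟩ ⟨u, hu⟩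
  obtain ⟨w⟩ := hr
  have : ∀ (a b : ((D : Finset (Fin n)) : Set (Fin n)))
      (_ : ((SimpleGraph.pathGraph n).induce ((D : Finset (Fin n)) : Set (Fin n))).Walk a b),
      a.1 ∈ ivl n p → b.1 ∈ ivl n p := by
    intro a b w
    induction w with
    | nil => exact id
    | @cons a b c hab w ih =>
      intro ha
      apply ih
      simp only [SimpleGraph.comap_adj, Function.Embedding.subtype_apply,
        SimpleGraph.pathGraph_adj] at hab
      obtain ⟨q, hq, hbq⟩ := mem_US.1 (hD b.2)
      by_cases hpq : p = q
      · rw [hpq]; exact hbq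
      · have hs : sepr p q := (hL.2.forall) hp hq hpq
        rw [mem_ivl] at ha hbq
        unfold sepr at hs
        omega
  exact this _ _ w hvp

theorem comps_US {n : ℕ} {L : List (ℕ × ℕ)} (hL : SepL n L) (C : Finset (Fin n)) :
    C ∈ comps (SimpleGraph.pathGraph n) (US n L) ↔ ∃ p ∈ L, ivl n p = C := by
  have hsub : ∀ p ∈ L, ivl n p ⊆ US n L := fun p hp v hv => mem_US.2 ⟨p, hp, hv⟩
  unfold comps
  simp only [Finset.mem_filter, Finset.mem_univ, true_and]
  constructor
  · rintro ⟨h1, h2, h3⟩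
    obtain ⟨⟨v, hv⟩⟩ := h2.nonempty
    obtain ⟨p, hp, hvp⟩ := mem_US.1 (h1 hv)
    have := hL.1 p hp
    exact ⟨p, hp, h3 _ (conn_sub hL h1 h2 hp hv hvp) (hsub p hp) (conn_ivl this.1 this.2)⟩
  · rintro ⟨p, hp, rfl⟩
    have := hL.1 p hp
    refine ⟨hsub p hp, conn_ivl this.1 this.2, ?_⟩
    intro D h1 h2 h3
    have h0 : (⟨p.1, by omega⟩ : Fin n) ∈ ivl n p := by rw [mem_ivl]; simp; omega
    exact Finset.Subset.antisymm (conn_sub hL h2 h3 hp (h1 h0) h0) h1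

theorem SepL.nodup {n : ℕ} {L : List (ℕ × ℕ)} (hL : SepL n L) : L.Nodup := by
  refine hL.2.imp ?_
  rintro a b h rfl
  unfold sepr at h; omega

theorem SepL.perm {n : ℕ} {L L' : List (ℕ × ℕ)} (hL : SepL n L) (h : L.Perm L') : SepL n L' :=
  ⟨fun p hp => hL.1 p (h.mem_iff.2 hp), hL.2.perm h (fun h => sepr_symm h)⟩

theorem US_perm {n : ℕ} {L L' : List (ℕ × ℕ)} (h : L.Perm L') : US n L = US n L' := by
  ext v; simp only [mem_US, h.mem_iff]

theorem nodup_map_ivl {n : ℕ} {L : List (ℕ × ℕ)} (hL : SepL n L) : (L.map (ivl n)).Nodup := by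
  refine List.Nodup.map_on ?_ hL.nodup
  intro p hp q hq h
  exact ivl_inj (hL.1 p hp).1 (hL.1 p hp).2 (hL.1 q hq).1 (hL.1 q hq).2 h

theorem comps_val {n : ℕ} {L : List (ℕ × ℕ)} (hL : SepL n L) :
    (comps (SimpleGraph.pathGraph n) (US n L)).val = ((L.map (ivl n) : List _) : Multiset _) := by
  rw [Multiset.Nodup.ext (Finset.nodup _) (by simpa using nodup_map_ivl hL)]
  intro C
  rw [Finset.mem_val, comps_US hL]
  simp

theorem cc_US {n : ℕ} {L : List (ℕ × ℕ)} (hL : SepL n L) :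
    ccMultiset (SimpleGraph.pathGraph n) (US n L) = ((L.map Prod.snd : List ℕ) : Multiset ℕ) := by
  unfold ccMultiset
  rw [comps_val hL, Multiset.map_coe, List.map_map]
  congr 1
  apply List.map_congr_left
  intro p hp
  exact card_ivl (hL.1 p hp).2

theorem card_comps {n : ℕ} {L : List (ℕ × ℕ)} (hL : SepL n L) :
    (comps (SimpleGraph.pathGraph n) (US n L)).card = L.length := by
  rw [Finset.card_def, comps_val hL]; simp

theorem adj_symm {n : ℕ} (U V : Finset (Fin n)) (h : adjCJ (SimpleGraph.pathGraph n) U V) :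
    adjCJ (SimpleGraph.pathGraph n) V U := ⟨h.1.symm, h.2.2, h.2.1⟩

theorem sdiff_aux {n : ℕ} {P P' : ℕ × ℕ} {R : List (ℕ × ℕ)} (h : SepL n (P :: R))
    (h' : SepL n (P' :: R)) (hne : P ≠ P') :
    (comps (SimpleGraph.pathGraph n) (US n (P :: R)) \
      comps (SimpleGraph.pathGraph n) (US n (P' :: R))).card = 1 := by
  rw [Finset.card_eq_one]
  refine ⟨ivl n P, ?_⟩
  ext C
  rw [Finset.mem_sdiff, comps_US h, comps_US h', Finset.mem_singleton]
  constructor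
  · rintro ⟨⟨p, hp, rfl⟩, h2⟩
    rcases List.mem_cons.1 hp with rfl | hp
    · rfl
    · exact absurd ⟨p, List.mem_cons_of_mem _ hp, rfl⟩ h2
  · rintro rfl
    refine ⟨⟨P, by simp, rfl⟩, ?_⟩
    rintro ⟨q, hq, he⟩
    have h1 := h.1 P (by simp)
    have h2 := h'.1 q hq
    have := ivl_inj h2.1 h2.2 h1.1 h1.2 he
    subst this
    rcases List.mem_cons.1 hq with rfl | hq
    · exact hne rfl
    · exact (List.nodup_cons.1 h.nodup).1 hq

abbrev RC (n : ℕ) := Rch (adjCJ (SimpleGraph.pathGraph n))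

theorem step_aux {n : ℕ} {P P' : ℕ × ℕ} {R L L' : List (ℕ × ℕ)} (h : SepL n L)
    (h' : SepL n L') (e : L.Perm (P :: R)) (e' : L'.Perm (P' :: R)) (hs : P.2 = P'.2) :
    RC n 1 (US n L) (US n L') := by
  rw [US_perm e, US_perm e']
  have h := h.perm e
  have h' := h'.perm e'
  by_cases hne : P = P'
  · subst hne; exact Rch.refl _ _
  · refine Rch.tail (Rch.refl 0 _) ⟨?_, sdiff_aux h h' hne, sdiff_aux h' h (Ne.symm hne)⟩
    rw [cc_US h, cc_US h']; simp [hs]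

def VV : ℕ → ℕ → List (ℕ × ℕ) → Prop
  | a, b, [] => a ≤ b
  | a, b, p :: L => a ≤ p.1 ∧ 1 ≤ p.2 ∧ VV (p.1 + p.2 + 1) b L

theorem VV.le {a b : ℕ} {L : List (ℕ × ℕ)} (h : VV a b L) : a ≤ b := by
  induction L generalizing a with
  | nil => exact h
  | cons p L ih => have := ih h.2.2; have := h.1; omega

theorem VV.left {a a' b : ℕ} {L : List (ℕ × ℕ)} (h : VV a b L) (ha : a' ≤ a) : VV a' b L := by
  cases L with
  | nil => exact le_trans ha h
  | cons p L => exact ⟨ha.trans h.1, h.2⟩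

theorem VV.append {a b c : ℕ} {L L' : List (ℕ × ℕ)} (h : VV a b L) (h' : VV b c L') :
    VV a c (L ++ L') := by
  induction L generalizing a with
  | nil => exact h'.left h
  | cons p L ih => exact ⟨h.1, h.2.1, ih h.2.2⟩

theorem VV.mem {a b : ℕ} {L : List (ℕ × ℕ)} (h : VV a b L) :
    ∀ p ∈ L, a ≤ p.1 ∧ 1 ≤ p.2 ∧ p.1 + p.2 + 1 ≤ b := by
  induction L generalizing a with
  | nil => simp
  | cons q L ih =>
    intro p hp
    have h1 := h.1
    rcases List.mem_cons.1 hp with rfl | hp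
    · exact ⟨h.1, h.2.1, h.2.2.le⟩
    · have := ih h.2.2 p hp
      omega

theorem VV.pw {a b : ℕ} {L : List (ℕ × ℕ)} (h : VV a b L) :
    L.Pairwise (fun p q => p.1 + p.2 < q.1) := by
  induction L generalizing a with
  | nil => exact List.Pairwise.nil
  | cons q L ih =>
    refine List.Pairwise.cons ?_ (ih h.2.2)
    intro p hp
    have := h.2.2.mem p hp
    omega

theorem VV.sep {n : ℕ} {L : List (ℕ × ℕ)} (h : VV 0 (n + 1) L) : SepL n L := by
  refine ⟨fun p hp => ?_, h.pw.imp (fun h => Or.inl h)⟩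
  have := h.mem p hp
  omega

theorem exists_list {n : ℕ} (A : Finset (Fin n)) : ∃ L, VV 0 (n + 1) L ∧ US n L = A := by
  have key : ∀ j m, m + j = n → ∃ L, VV m (n + 1) L ∧ ∀ v : Fin n, v ∈ US n L ↔ v ∈ A ∧ m ≤ v.val := by
    intro j
    induction j with
    | zero =>
      intro m hm
      refine ⟨[], by simp only [VV]; omega, ?_⟩
      intro v
      simp only [mem_US, List.not_mem_nil, false_and, exists_false, false_iff]
      have := v.2
      omega
    | succ j ih =>
      intro m hm
      obtain ⟨L, hL, hU⟩ := ih (m + 1) (by omega)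
      by_cases hmA : (⟨m, by omega⟩ : Fin n) ∈ A
      · have hA : ∀ v : Fin n, (v ∈ A ∧ m ≤ v.val) ↔ (v.val = m ∨ v ∈ US n L) := by
          intro v
          rw [hU]
          constructor
          · rintro ⟨h1, h2⟩
            rcases Nat.eq_or_lt_of_le h2 with h | h
            · exact Or.inl h.symm
            · exact Or.inr ⟨h1, h⟩
          · rintro (h | h)
            · subst h; exact ⟨hmA, le_rfl⟩
            · exact ⟨h.1, by omega⟩
        have hdef : VV (m + 2) (n + 1) L → ∃ L, VV m (n + 1) L ∧
            ∀ v : Fin n, v ∈ US n L ↔ v ∈ A ∧ m ≤ v.val := by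
          intro h
          refine ⟨(m, 1) :: L, ⟨le_rfl, le_rfl, h⟩, ?_⟩
          intro v
          rw [hA]
          simp only [mem_US, List.mem_cons, exists_eq_or_imp, mem_ivl]
          have : (m ≤ v.val ∧ v.val < m + 1) ↔ v.val = m := by omega
          rw [this]
        rcases L with _ | ⟨⟨s, x⟩, L⟩
        · apply hdef; simp only [VV]; omega
        · by_cases hs : s = m + 1
          · subst hs
            refine ⟨(m, x + 1) :: L, ⟨le_rfl, by simp, ?_⟩, ?_⟩
            · exact hL.2.2.left (by simp; omega)
            · intro v
              rw [hA]
              simp only [mem_US, List.mem_cons, exists_eq_or_imp, mem_ivl]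
              rw [← or_assoc]
              apply or_congr_left
              omega
          · apply hdef
            have := hL.1
            refine ⟨?_, hL.2⟩
            simp only at this ⊢
            omega
      · refine ⟨L, hL.left (by omega), ?_⟩
        intro v
        rw [hU]
        constructor
        · rintro ⟨h1, h2⟩; exact ⟨h1, by omega⟩
        · rintro ⟨h1, h2⟩
          refine ⟨h1, ?_⟩
          rcases Nat.eq_or_lt_of_le h2 with h | h
          · subst h; exact absurd h1 hmA
          · exact h
  obtain ⟨L, hL, hU⟩ := key n 0 (by omega)
  exact ⟨L, hL, by ext v; rw [hU]; simp⟩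

theorem hseq_US {n : ℕ} {L : List (ℕ × ℕ)} (h : VV 0 (n + 1) L) :
    hseq n (US n L) = L.map Prod.snd := by
  have hs := h.sep
  let M : List (WithTop (Fin n)) := L.map (fun p => (ivl n p).min)
  have hM : M.Pairwise (· < ·) := by
    show (L.map (fun p => (ivl n p).min)).Pairwise (· < ·)
    rw [List.pairwise_map]
    refine List.Pairwise.imp_of_mem ?_ h.pw
    intro p q hp hq hpq
    rw [min_ivl (hs.1 p hp).1 (hs.1 p hp).2, min_ivl (hs.1 q hq).1 (hs.1 q hq).2]
    norm_cast
    show p.1 < q.1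
    omega
  have e : (comps (SimpleGraph.pathGraph n) (US n L)).image (fun C => C.min) = M.toFinset := by
    ext m
    simp only [Finset.mem_image, comps_US hs, List.mem_toFinset, M, List.mem_map]
    constructor
    · rintro ⟨C, ⟨p, hp, rfl⟩, rfl⟩; exact ⟨p, hp, rfl⟩
    · rintro ⟨p, hp, rfl⟩; exact ⟨_, ⟨p, hp, rfl⟩, rfl⟩
  unfold hseq
  rw [e, (List.toFinset_sort (· ≤ ·) (hM.imp (fun h => ne_of_lt h))).2 (hM.imp (fun h => le_of_lt h))]
  show (L.map (fun p => (ivl n p).min)).map _ = _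
  rw [List.map_map]
  apply List.map_congr_left
  intro p hp
  have : (comps (SimpleGraph.pathGraph n) (US n L)).filter (fun C => C.min = (ivl n p).min)
      = {ivl n p} := by
    ext C
    simp only [Finset.mem_filter, comps_US hs, Finset.mem_singleton]
    constructor
    · rintro ⟨⟨q, hq, rfl⟩, hm⟩
      rw [min_ivl (hs.1 p hp).1 (hs.1 p hp).2, min_ivl (hs.1 q hq).1 (hs.1 q hq).2] at hm
      have hm : q.1 = p.1 := by simpa using WithTop.coe_injective hm
      by_cases hpq : p = q
      · rw [hpq]
      · have hs' : sepr p q := (hs.2.forall) hp hq hpq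
        unfold sepr at hs'
        omega
    · rintro rfl; exact ⟨⟨p, hp, rfl⟩, rfl⟩
  simp only [Function.comp]
  rw [this, Finset.sup_singleton, card_ivl (hs.1 p hp).2]

def wt (f : ℕ → ℕ) : List ℕ → ℕ
  | [] => 0
  | q :: l => f q + 1 + wt f l

def lpk (f : ℕ → ℕ) : ℕ → List ℕ → List (ℕ × ℕ)
  | _, [] => []
  | s, q :: l => (s, f q) :: lpk f (s + f q + 1) l

theorem wt_append (f : ℕ → ℕ) (l l' : List ℕ) : wt f (l ++ l') = wt f l + wt f l' := by
  induction l with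
  | nil => simp [wt]
  | cons q l ih => simp [wt, ih]; omega

theorem wt_perm (f : ℕ → ℕ) {l l' : List ℕ} (h : l.Perm l') : wt f l = wt f l' := by
  induction h with
  | nil => rfl
  | cons x h ih => simp [wt, ih]
  | swap x y l => simp [wt]; omega
  | trans h1 h2 i1 i2 => exact i1.trans i2

theorem lp_append (f : ℕ → ℕ) (s : ℕ) (l l' : List ℕ) :
    lpk f s (l ++ l') = lpk f s l ++ lpk f (s + wt f l) l' := by
  induction l generalizing s with
  | nil => simp [wt, lpk]
  | cons q l ih =>
    simp only [List.cons_append, lpk, wt, ih]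
    congr 3
    omega

theorem VV_lp {f : ℕ → ℕ} (hf : ∀ q, 1 ≤ f q) (s t : ℕ) (l : List ℕ) (h : s + wt f l ≤ t) :
    VV s t (lpk f s l) := by
  induction l generalizing s with
  | nil => simpa [wt, lpk, VV] using h
  | cons q l ih => exact ⟨le_rfl, hf q, ih _ (by simp only [wt] at h; simp only; omega)⟩

def conf (n : ℕ) (f : ℕ → ℕ) (l1 l2 : List ℕ) : List (ℕ × ℕ) :=
  lpk f 0 l1 ++ lpk f (n + 1 - wt f l2) l2

theorem VV_conf {n : ℕ} {f : ℕ → ℕ} (hf : ∀ q, 1 ≤ f q) {l1 l2 : List ℕ}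
    (h : wt f l1 + wt f l2 ≤ n + 1) : VV 0 (n + 1) (conf n f l1 l2) :=
  (VV_lp hf 0 _ l1 (by omega)).append (b := n + 1 - wt f l2) (VV_lp hf _ _ l2 (by omega))

theorem step1 {n : ℕ} {L1 L2 : List (ℕ × ℕ)} {s s' x : ℕ} (h : VV 0 (n + 1) (L1 ++ (s, x) :: L2))
    (h' : VV 0 (n + 1) (L1 ++ (s', x) :: L2)) :
    RC n 1 (US n (L1 ++ (s, x) :: L2)) (US n (L1 ++ (s', x) :: L2)) :=
  step_aux h.sep h'.sep List.perm_middle List.perm_middle rfl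

theorem step2 {n : ℕ} {L1 L2 : List (ℕ × ℕ)} {s s' x : ℕ} {Q : ℕ × ℕ}
    (h : VV 0 (n + 1) (L1 ++ (s, x) :: Q :: L2))
    (h' : VV 0 (n + 1) (L1 ++ Q :: (s', x) :: L2)) :
    RC n 1 (US n (L1 ++ (s, x) :: Q :: L2)) (US n (L1 ++ Q :: (s', x) :: L2)) := by
  refine step_aux (P := (s, x)) (P' := (s', x)) h.sep h'.sep List.perm_middle ?_ rfl
  exact (List.perm_middle (l₁ := L1 ++ [Q]) (l₂ := L2)).symm.symm.trans (by simp) |> fun h => by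
    simpa using h

theorem mv {n : ℕ} {f : ℕ → ℕ} (hf : ∀ q, 1 ≤ f q) {l1 l2 : List ℕ} {x : ℕ}
    (h : wt f l1 + (f x + 1) + wt f l2 ≤ n + 1) :
    RC n 1 (US n (conf n f l1 (x :: l2))) (US n (conf n f (l1 ++ [x]) l2)) := by
  have v1 := VV_conf (n := n) hf (l1 := l1) (l2 := x :: l2) (by simp only [wt]; omega)
  have v2 := VV_conf (n := n) hf (l1 := l1 ++ [x]) (l2 := l2) (by simp only [wt, wt_append]; omega)
  have e1 : conf n f l1 (x :: l2) = lpk f 0 l1 ++ (n + 1 - wt f (x :: l2), f x) ::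
      lpk f (n + 1 - wt f l2) l2 := by
    simp only [conf, lpk, wt]
    congr 3
    omega
  have e2 : conf n f (l1 ++ [x]) l2 = lpk f 0 l1 ++ (wt f l1, f x) ::
      lpk f (n + 1 - wt f l2) l2 := by
    simp [conf, lpk, lp_append]
  rw [e1] at v1 ⊢
  rw [e2] at v2 ⊢
  exact step1 v1 v2

theorem mv' {n : ℕ} {f : ℕ → ℕ} (hf : ∀ q, 1 ≤ f q) {l1 l2 : List ℕ} {x : ℕ}
    (h : wt f l1 + (f x + 1) + wt f l2 ≤ n + 1) :
    RC n 1 (US n (conf n f (l1 ++ [x]) l2)) (US n (conf n f l1 (x :: l2))) :=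
  (mv hf h).symm adj_symm

/-- the left-hand element jumps over -/
theorem swp {n : ℕ} {f : ℕ → ℕ} (hf : ∀ q, 1 ≤ f q) {l1 l2 : List ℕ} {x y : ℕ}
    (h : wt f l1 + (f x + 1) + (f y + 1) + wt f l2 + (f x + 1) ≤ n + 1) :
    RC n 2 (US n (conf n f (l1 ++ [x, y]) l2)) (US n (conf n f (l1 ++ [y]) (x :: l2))) := by
  have v1 := VV_conf (n := n) hf (l1 := l1 ++ [x, y]) (l2 := l2)
    (by simp only [wt, wt_append]; omega)
  have v2 := VV_conf (n := n) hf (l1 := l1 ++ [y]) (l2 := x :: l2)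
    (by simp only [wt, wt_append]; omega)
  have e1 : conf n f (l1 ++ [x, y]) l2 = lpk f 0 l1 ++ (wt f l1, f x) ::
      (wt f l1 + f x + 1, f y) :: lpk f (n + 1 - wt f l2) l2 := by
    simp [conf, lpk, lp_append]
  have e2 : conf n f (l1 ++ [y]) (x :: l2) = lpk f 0 l1 ++ (wt f l1, f y) ::
      (n + 1 - wt f (x :: l2), f x) :: lpk f (n + 1 - wt f l2) l2 := by
    simp only [conf, lpk, lp_append, wt, List.append_assoc, List.singleton_append]
    congr 3
    · omega
    · congr 2; omega
  have v3 : VV 0 (n + 1) (lpk f 0 l1 ++ (wt f l1 + f x + 1, f y) ::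
      (n + 1 - wt f (x :: l2), f x) :: lpk f (n + 1 - wt f l2) l2) := by
    refine (VV_lp hf 0 (wt f l1) l1 (by omega)).append ⟨?_, hf y, ?_, hf x, ?_⟩
    · simp only; omega
    · simp only [wt]; omega
    · refine (VV_lp hf _ _ l2 (by omega)).left ?_
      simp only [wt]; omega
  rw [e1] at v1 ⊢
  rw [e2] at v2 ⊢
  exact (step2 v1 v3).trans (step1 v3 v2)

/-- the right-hand element jumps over -/
theorem swp' {n : ℕ} {f : ℕ → ℕ} (hf : ∀ q, 1 ≤ f q) {l1 l2 : List ℕ} {x y : ℕ}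
    (h : wt f l1 + (f x + 1) + (f y + 1) + wt f l2 + (f y + 1) ≤ n + 1) :
    RC n 2 (US n (conf n f l1 (x :: y :: l2))) (US n (conf n f (l1 ++ [y]) (x :: l2))) := by
  have v1 := VV_conf (n := n) hf (l1 := l1) (l2 := x :: y :: l2)
    (by simp only [wt]; omega)
  have v2 := VV_conf (n := n) hf (l1 := l1 ++ [y]) (l2 := x :: l2)
    (by simp only [wt, wt_append]; omega)
  have e1 : conf n f l1 (x :: y :: l2) = lpk f 0 l1 ++ (n + 1 - wt f (x :: y :: l2), f x) ::
      (n + 1 - wt f (y :: l2), f y) :: lpk f (n + 1 - wt f l2) l2 := by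
    simp only [conf, lpk, wt]
    congr 3
    · congr 1; omega
    · congr 1; omega
  have e2 : conf n f (l1 ++ [y]) (x :: l2) = lpk f 0 l1 ++ (wt f l1, f y) ::
      (n + 1 - wt f (x :: l2), f x) :: lpk f (n + 1 - wt f l2) l2 := by
    simp only [conf, lpk, lp_append, wt, List.append_assoc, List.singleton_append]
    congr 3
    · omega
    · congr 2; omega
  have v3 : VV 0 (n + 1) (lpk f 0 l1 ++ (wt f l1, f y) ::
      (n + 1 - wt f (x :: y :: l2), f x) :: lpk f (n + 1 - wt f l2) l2) := by
    refine (VV_lp hf 0 (wt f l1) l1 (by omega)).append ⟨?_, hf y, ?_, hf x, ?_⟩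
    · simp only; omega
    · simp only [wt]; omega
    · refine (VV_lp hf _ _ l2 (by omega)).left ?_
      simp only [wt]; omega
  rw [e1] at v1 ⊢
  rw [e2] at v2 ⊢
  refine Rch.trans (m := 1) (m' := 1) ((step2 v3 v1).symm adj_symm) ?_
  have := step1 (n := n) (L1 := lpk f 0 l1 ++ [(wt f l1, f y)]) (by simpa using v3)
    (by simpa using v2)
  simpa using this

theorem ins {n : ℕ} {f : ℕ → ℕ} (hf : ∀ q, 1 ≤ f q) (S : ℕ) (y : ℕ) (l1 : List ℕ) :
    ∀ l2 : List ℕ, wt f l1 + (f y + 1) + wt f l2 + S ≤ n + 1 →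
    l1.Pairwise (· ≤ ·) →
    (∀ x ∈ l1, y < x → min (f x) (f y) + 1 ≤ S) →
    ∃ l', l'.Perm (l1 ++ [y]) ∧ l'.Pairwise (· ≤ ·) ∧
      RC n (5 * l1.length + 1) (US n (conf n f l1 (y :: l2))) (US n (conf n f l' l2)) := by
  induction l1 using List.reverseRecOn with
  | nil =>
    intro l2 h _ _
    exact ⟨[y], by simp, by simp, (mv hf (l1 := []) (by omega)).mono (by simp)⟩
  | append_singleton l1 x ih =>
    intro l2 h hs hc
    rw [wt_append] at h
    simp only [wt] at h
    by_cases hxy : y < x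
    · have hm := hc x (by simp) hxy
      obtain ⟨l', p1, p2, p3⟩ := ih (x :: l2) (by simp only [wt]; omega)
        (List.pairwise_append.1 hs).1 (fun z hz => hc z (by simp [hz]))
      refine ⟨l' ++ [x], ?_, ?_, ?_⟩
      · have : (l' ++ [x]).Perm (l1 ++ [y] ++ [x]) := p1.append_right _
        refine this.trans ?_
        simp only [List.append_assoc]
        exact List.Perm.append_left _ (List.Perm.swap _ _ _)
      · rw [List.pairwise_append]
        refine ⟨p2, by simp, ?_⟩
        intro a ha b hb
        simp only [List.mem_singleton] at hb
        subst hb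
        rw [p1.mem_iff] at ha
        rcases List.mem_append.1 ha with ha | ha
        · exact (List.pairwise_append.1 hs).2.2 a ha b (by simp)
        · simp only [List.mem_singleton] at ha
          omega
      · have sw : RC n 3 (US n (conf n f (l1 ++ [x]) (y :: l2)))
            (US n (conf n f (l1 ++ [y]) (x :: l2))) := by
          rcases le_total (f x) (f y) with hle | hle
          · rw [min_eq_left hle] at hm
            have a := mv (n := n) hf (l1 := l1 ++ [x]) (l2 := l2) (x := y)
              (by simp only [wt, wt_append]; omega)
            rw [List.append_assoc] at a
            exact a.trans (swp hf (by omega))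
          · rw [min_eq_right hle] at hm
            have a := mv' (n := n) hf (l1 := l1) (l2 := y :: l2) (x := x)
              (by simp only [wt]; omega)
            exact a.trans (swp' hf (by omega))
        have m1 := mv' (n := n) hf (l1 := l1) (l2 := x :: l2) (x := y)
              (by simp only [wt]; omega)
        have m2 := mv (n := n) hf (l1 := l') (l2 := l2) (x := x)
              (by rw [wt_perm f p1, wt_append]; simp only [wt]; omega)
        exact (((sw.trans m1).trans p3).trans m2).mono (by simp; omega)
    · refine ⟨l1 ++ [x] ++ [y], List.Perm.refl _, ?_, ?_⟩
      · rw [List.pairwise_append]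
        refine ⟨hs, by simp, ?_⟩
        intro a ha b hb
        simp only [List.mem_singleton] at hb
        subst hb
        rcases List.mem_append.1 ha with ha | ha
        · have := (List.pairwise_append.1 hs).2.2 a ha x (by simp)
          omega
        · simp only [List.mem_singleton] at ha
          omega
      · exact (mv hf (by simp only [wt_append, wt]; omega)).mono (by omega)

theorem srt {n : ℕ} {f : ℕ → ℕ} (hf : ∀ q, 1 ≤ f q) (S : ℕ) (K : ℕ) (l2 : List ℕ) :
    ∀ l1 : List ℕ, wt f l1 + wt f l2 + S ≤ n + 1 → l1.Pairwise (· ≤ ·) →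
    l1.length + l2.length ≤ K →
    (∀ x ∈ l1, ∀ y ∈ l2, y < x → min (f x) (f y) + 1 ≤ S) →
    l2.Pairwise (fun x y => y < x → min (f x) (f y) + 1 ≤ S) →
    ∃ l', l'.Perm (l1 ++ l2) ∧ l'.Pairwise (· ≤ ·) ∧
      RC n (l2.length * (5 * K + 1)) (US n (conf n f l1 l2)) (US n (conf n f l' [])) := by
  induction l2 with
  | nil =>
    intro l1 h hs hk _ _
    exact ⟨l1, by simp, hs, Rch.refl _ _⟩
  | cons y l2 ih =>
    intro l1 h hs hk hc hp
    simp only [wt] at h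
    rw [List.pairwise_cons] at hp
    simp only [List.length_cons] at hk
    obtain ⟨l', p1, p2, p3⟩ := ins (n := n) hf S y l1 l2 (by omega) hs
      (fun x hx => hc x hx y (by simp))
    have hlen := p1.length_eq
    simp only [List.length_append, List.length_singleton] at hlen
    obtain ⟨l'', q1, q2, q3⟩ := ih l' (by rw [wt_perm f p1, wt_append]; simp only [wt]; omega) p2
      (by omega) (by
        intro x hx z hz
        rw [p1.mem_iff] at hx
        rcases List.mem_append.1 hx with hx | hx
        · exact hc x hx z (by simp [hz])
        · simp only [List.mem_singleton] at hx
          subst hx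
          exact hp.1 z hz) hp.2
    refine ⟨l'', ?_, q2, ?_⟩
    · refine q1.trans ((p1.append_right _).trans ?_)
      simp
    · refine (p3.trans q3).mono ?_
      simp only [List.length_cons]
      nlinarith

theorem pack {n : ℕ} {f : ℕ → ℕ} (hf : ∀ q, 1 ≤ f q) (L : List (ℕ × ℕ)) :
    ∀ l1 l2 : List ℕ, L.map Prod.snd = l2.map f → VV (wt f l1) (n + 1) L →
    RC n L.length (US n (lpk f 0 l1 ++ L)) (US n (lpk f 0 (l1 ++ l2))) := by
  induction L with
  | nil =>
    intro l1 l2 h _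
    have : l2 = [] := by simpa using h.symm
    subst this
    simpa using Rch.refl _ _
  | cons p L ih =>
    intro l1 l2 h hv
    obtain ⟨s, x⟩ := p
    rcases l2 with _ | ⟨q, l2⟩
    · simp at h
    · simp only [List.map_cons, List.cons.injEq] at h
      obtain ⟨hx, h⟩ := h
      subst hx
      obtain ⟨h1, h2, h3⟩ := hv
      simp only at h1 h3
      have a := ih (l1 ++ [q]) l2 h (h3.left (by simp only [wt_append, wt]; omega))
      have e : lpk f 0 (l1 ++ [q]) ++ L = lpk f 0 l1 ++ (wt f l1, f q) :: L := by
        simp [lp_append, lpk]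
      rw [e] at a
      have vl := VV_lp hf 0 (wt f l1) l1 (by omega)
      have b := step1 (n := n) (L1 := lpk f 0 l1) (L2 := L) (s := s) (s' := wt f l1) (x := f q)
        (vl.append ⟨h1, h2, h3⟩) (vl.append ⟨le_rfl, h2, h3.left (by simp only; omega)⟩)
      have c := b.trans a
      simp only [List.append_assoc, List.singleton_append] at c
      exact c.mono (by simp; omega)

theorem unpack {n : ℕ} {f : ℕ → ℕ} (hf : ∀ q, 1 ≤ f q) (l2 : List ℕ) :
    ∀ l1 : List ℕ, wt f l1 + wt f l2 ≤ n + 1 →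
    RC n l2.length (US n (conf n f l1 l2)) (US n (conf n f (l1 ++ l2) [])) := by
  induction l2 with
  | nil => intro l1 _; simpa using Rch.refl _ _
  | cons q l2 ih =>
    intro l1 h
    simp only [wt] at h
    have a := mv (n := n) hf (l1 := l1) (l2 := l2) (x := q) (by omega)
    have b := ih (l1 ++ [q]) (by simp only [wt_append, wt]; omega)
    have c := a.trans b
    simp only [List.append_assoc, List.singleton_append] at c
    exact c.mono (by simp; omega)

theorem exists_occ (l : List ℕ) (a c : ℕ) (h1 : 1 ≤ c) (h2 : c ≤ l.count a) :
    ∃ q < l.length, l.getD q 0 = a ∧ (l.take (q + 1)).count a = c := by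
  induction l generalizing c with
  | nil => simp at h2; omega
  | cons x l ih =>
    by_cases hx : x = a
    · subst hx
      by_cases hc : c = 1
      · exact ⟨0, by simp, by simp, by simp [hc]⟩
      · simp only [List.count_cons_self] at h2
        obtain ⟨q, hq, e1, e2⟩ := ih (c - 1) (by omega) (by omega)
        refine ⟨q + 1, by simpa using hq, by simpa using e1, ?_⟩
        rw [List.take_succ_cons, List.count_cons_self, e2]
        omega
    · rw [List.count_cons_of_ne hx] at h2
      obtain ⟨q, hq, e1, e2⟩ := ih c h1 h2
      refine ⟨q + 1, by simpa using hq, by simpa using e1, ?_⟩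
      rw [List.take_succ_cons, List.count_cons_of_ne hx, e2]

theorem count_take_lt (l : List ℕ) (p q a : ℕ) (hpq : p < q) (hq : q < l.length)
    (ha : l.getD q 0 = a) : (l.take (p + 1)).count a < (l.take (q + 1)).count a := by
  rw [List.getD_eq_getElem _ _ hq] at ha
  have h1 : (l.take (p + 1)).count a ≤ (l.take q).count a := by
    apply List.Sublist.count_le
    exact (List.take_prefix_take_left (by omega)).sublist
  have h2 : (l.take (q + 1)).count a = (l.take q).count a + 1 := by
    rw [List.take_succ_eq_append_getElem hq, List.count_append, ha]
    simp
  omega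

theorem match_spec {hA hB : List ℕ} (h : hA.Perm hB) {p : ℕ} (hp : p < hA.length) :
    matchIdx hA hB p < hB.length ∧ hB.getD (matchIdx hA hB p) 0 = hA.getD p 0 ∧
    (hB.take (matchIdx hA hB p + 1)).count (hA.getD p 0) =
      (hA.take (p + 1)).count (hA.getD p 0) := by
  have hc1 : 1 ≤ (hA.take (p + 1)).count (hA.getD p 0) := by
    rw [Nat.one_le_iff_ne_zero, ← Nat.pos_iff_ne_zero, List.count_pos_iff,
      List.getD_eq_getElem _ _ hp, List.mem_take_iff_getElem]
    exact ⟨p, by omega, rfl⟩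
  have hc2 : (hA.take (p + 1)).count (hA.getD p 0) ≤ hB.count (hA.getD p 0) := by
    rw [← h.count_eq]
    exact (List.take_sublist _ _).count_le _
  obtain ⟨q, hq, e1, e2⟩ := exists_occ hB _ _ hc1 hc2
  unfold matchIdx
  rcases hfd : (List.range hB.length).find? (fun q =>
    decide (hB.getD q 0 = hA.getD p 0 ∧
      (hB.take (q + 1)).count (hA.getD p 0) = (hA.take (p + 1)).count (hA.getD p 0))) with _ | r
  · rw [List.find?_eq_none] at hfd
    have := hfd q (by simpa using hq)
    simp only [decide_eq_true_eq] at this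
    exact absurd ⟨e1, e2⟩ this
  · have h1 := List.mem_of_find?_eq_some hfd
    have h2 := List.find?_some hfd
    simp only [decide_eq_true_eq] at h2
    simp only [Option.getD_some]
    exact ⟨by simpa using h1, h2.1, h2.2⟩

theorem match_inj {hA hB : List ℕ} (h : hA.Perm hB) {p q : ℕ} (hp : p < hA.length)
    (hq : q < hA.length) (e : matchIdx hA hB p = matchIdx hA hB q) : p = q := by
  obtain ⟨_, a1, a2⟩ := match_spec h hp
  obtain ⟨_, b1, b2⟩ := match_spec h hq
  rw [e] at a1 a2
  have e3 : hA.getD p 0 = hA.getD q 0 := a1.symm.trans b1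
  rw [e3] at a2
  have e4 := a2.symm.trans b2
  rcases lt_trichotomy p q with hlt | heq | hlt
  · have := count_take_lt hA p q _ hlt hq rfl
    omega
  · exact heq
  · have := count_take_lt hA q p _ hlt hp e3
    omega

theorem match_perm {hA hB : List ℕ} (h : hA.Perm hB) :
    ((List.range hA.length).map (matchIdx hA hB)).Perm (List.range hA.length) := by
  have hn : ((List.range hA.length).map (matchIdx hA hB)).Nodup := by
    refine List.Nodup.map_on ?_ List.nodup_range
    intro p hp q hq e
    exact match_inj h (by simpa using hp) (by simpa using hq) e
  have hsub : ((List.range hA.length).map (matchIdx hA hB)) ⊆ (List.range hA.length) := by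
    intro x hx
    obtain ⟨p, hp, rfl⟩ := List.mem_map.1 hx
    rw [List.mem_range] at hp ⊢
    rw [h.length_eq]
    exact (match_spec h hp).1
  exact (hn.subperm hsub).perm_of_length_le (by simp)

theorem wt_eq (f : ℕ → ℕ) (l : List ℕ) : wt f l = (l.map f).sum + l.length := by
  induction l with
  | nil => rfl
  | cons q l ih => simp only [wt, ih, List.map_cons, List.sum_cons, List.length_cons]; omega

theorem VV_wt {a b : ℕ} {L : List (ℕ × ℕ)} (h : VV a b L) :
    a + (L.map Prod.snd).sum + L.length ≤ b := by
  induction L generalizing a with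
  | nil => simpa [VV] using h
  | cons p L ih =>
    have := ih h.2.2
    have := h.1
    simp only [List.map_cons, List.sum_cons, List.length_cons]
    omega

theorem card_US {n : ℕ} {a b : ℕ} {L : List (ℕ × ℕ)} (h : VV a b L) (hb : b ≤ n + 1) :
    (US n L).card = (L.map Prod.snd).sum := by
  induction L generalizing a with
  | nil => simp [US]
  | cons p L ih =>
    have e : US n (p :: L) = ivl n p ∪ US n L := by
      ext v; simp [mem_US]
    have hm := h.2.2.mem
    have hle := h.2.2.le
    rw [e, Finset.card_union_of_disjoint, ih h.2.2, card_ivl (by omega)]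
    · simp
    · rw [Finset.disjoint_left]
      intro v hv hv'
      obtain ⟨q, hq, hvq⟩ := mem_US.1 hv'
      rw [mem_ivl] at hv hvq
      have := hm q hq
      omega

theorem main_aux {n : ℕ} {LA LB : List (ℕ × ℕ)} (vA : VV 0 (n + 1) LA) (vB : VV 0 (n + 1) LB)
    (hperm : (LA.map Prod.snd).Perm (LB.map Prod.snd))
    (hinv : ∀ p q, IsInv (LA.map Prod.snd) (LB.map Prod.snd) p q →
        min ((LA.map Prod.snd).getD p 0) ((LA.map Prod.snd).getD q 0) ≤
          n - (LA.map Prod.snd).sum - LA.length) :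
    RC n (10 * n ^ 2) (US n LA) (US n LB) := by
  obtain ⟨hA, ehA⟩ : ∃ hA, hA = LA.map Prod.snd := ⟨_, rfl⟩
  obtain ⟨hB, ehB⟩ : ∃ hB, hB = LB.map Prod.snd := ⟨_, rfl⟩
  rw [← ehA, ← ehB] at hperm hinv
  have lenA : hA.length = LA.length := by rw [ehA]; simp
  have lenB : hB.length = LB.length := by rw [ehB]; simp
  have lenAB := hperm.length_eq
  have posA : ∀ x ∈ hA, 1 ≤ x := by
    intro x hx
    rw [ehA] at hx
    obtain ⟨p, hp, rfl⟩ := List.mem_map.1 hx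
    exact (vA.mem p hp).2.1
  have posB : ∀ x ∈ hB, 1 ≤ x := fun x hx => posA x (hperm.mem_iff.2 hx)
  let f : ℕ → ℕ := fun q => hB.getD q 1
  have hf : ∀ q, 1 ≤ f q := by
    intro q
    show 1 ≤ hB.getD q 1
    by_cases hq : q < hB.length
    · rw [List.getD_eq_getElem _ _ hq]; exact posB _ (List.getElem_mem _)
    · rw [List.getD_eq_default _ _ (by omega)]
  have hf0 : ∀ q, q < hB.length → f q = hB.getD q 0 := by
    intro q hq
    show hB.getD q 1 = _
    rw [List.getD_eq_getElem _ _ hq, List.getD_eq_getElem _ _ hq]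
  obtain ⟨l, el⟩ : ∃ l, l = (List.range hA.length).map (matchIdx hA hB) := ⟨_, rfl⟩
  have lperm : l.Perm (List.range hA.length) := el ▸ match_perm hperm
  have fm : ∀ p < hA.length, f (matchIdx hA hB p) = hA.getD p 0 := by
    intro p hp
    have := match_spec hperm hp
    rw [hf0 _ this.1, this.2.1]
  have lA : LA.map Prod.snd = l.map f := by
    rw [← ehA, el, List.map_map]
    apply List.ext_getElem (by simp)
    intro i h1 h2
    simp only [List.getElem_map, List.getElem_range, Function.comp]
    rw [fm i h1, List.getD_eq_getElem _ _ h1]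
  have lB : LB.map Prod.snd = (List.range hA.length).map f := by
    rw [← ehB]
    apply List.ext_getElem (by simp [lenAB])
    intro i h1 h2
    simp only [List.getElem_map, List.getElem_range]
    rw [hf0 i h1, List.getD_eq_getElem _ _ h1]
  have llen : l.length = LA.length := by rw [el]; simp [lenA]
  have wA : wt f l = hA.sum + LA.length := by rw [wt_eq, ← lA, ← ehA, llen]
  have hW := VV_wt vA
  rw [← ehA] at hW
  have hK : 2 * LA.length ≤ n + 1 := by
    have : LA.length ≤ hA.sum := by
      rw [← lenA]
      have := List.card_nsmul_le_sum hA 1 posA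
      simpa using this
    omega
  have s1 := pack (n := n) hf LA [] l lA vA
  have s2 := (unpack (n := n) hf l [] (by simp only [wt]; omega)).symm adj_symm
  obtain ⟨l', p1, p2, s3⟩ := srt (n := n) hf (n + 1 - wt f l) LA.length l [] 
    (by simp only [wt]; omega) List.Pairwise.nil (by simp [llen]) (by simp) (by
      rw [el, List.pairwise_map, ← el]
      refine List.Pairwise.imp_of_mem ?_ (List.pairwise_lt_range (n := hA.length))
      intro p q hp hq hpq hlt
      rw [List.mem_range] at hp hq
      have := hinv p q ⟨hpq, hq, hlt⟩
      have h1 := hf (matchIdx hA hB p)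
      have h2 := hf (matchIdx hA hB q)
      rw [← fm p hp, ← fm q hq] at this
      rw [wA]
      omega)
  have s4 := (pack (n := n) hf LB [] (List.range hA.length) lB vB).symm adj_symm
  have el' : l' = List.range hA.length := by
    refine List.Perm.eq_of_pairwise' p2 (List.pairwise_le_range) ?_
    exact p1.trans (by simpa using lperm)
  rw [el'] at s3
  simp only [conf, lpk, List.nil_append, List.append_nil] at s1 s2 s3 s4
  refine (((s1.trans s2).trans s3).trans s4).mono ?_
  have hB' : LB.length = LA.length := by omega
  rw [hB', llen]
  generalize LA.length = K at hK
  have : K ≤ n := by omega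
  have h1 : K * K ≤ n * n := Nat.mul_le_mul this this
  have h2 : K ≤ K * K := Nat.le_mul_self K
  nlinarith

/-- If every inversion between `h'_A` and `h'_B` fits in the buffer
`b(A, k) = n - |A| - k`, then there is a reconfiguration sequence from `A` to `B`
under CJ of length at most `c · n²` for an absolute constant `c`. -/
theorem stmt6 :
    ∃ c : ℕ, ∀ (n k : ℕ) (A B : Finset (Fin n)),
      ccMultiset (SimpleGraph.pathGraph n) A = ccMultiset (SimpleGraph.pathGraph n) B →
      (comps (SimpleGraph.pathGraph n) A).card = k →
      (comps (SimpleGraph.pathGraph n) B).card = k →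
      (∀ p q, IsInv (hseq n A) (hseq n B) p q →
        min ((hseq n A).getD p 0) ((hseq n A).getD q 0) ≤ n - A.card - k) →
      ∃ (ℓ : ℕ) (W : ℕ → Finset (Fin n)), W 0 = A ∧ W ℓ = B ∧
        (∀ i ≤ ℓ, ccMultiset (SimpleGraph.pathGraph n) (W i) =
          ccMultiset (SimpleGraph.pathGraph n) A) ∧
        (∀ i < ℓ, adjCJ (SimpleGraph.pathGraph n) (W i) (W (i + 1))) ∧
        ℓ ≤ c * n ^ 2 := by
  refine ⟨10, ?_⟩
  intro n k A B hcc hkA hkB hinv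
  obtain ⟨LA, vA, rfl⟩ := exists_list A
  obtain ⟨LB, vB, rfl⟩ := exists_list B
  rw [hseq_US vA, hseq_US vB, card_US vA le_rfl] at hinv
  rw [card_comps vA.sep] at hkA
  subst hkA
  have hperm : (LA.map Prod.snd).Perm (LB.map Prod.snd) := by
    rw [cc_US vA.sep, cc_US vB.sep] at hcc
    exact Multiset.coe_eq_coe.1 hcc
  obtain ⟨l, W, h0, hl, hs, hm⟩ := (main_aux vA vB hperm hinv).seq
  refine ⟨l, W, h0, hl, ?_, hs, hm⟩
  intro i
  induction i with
  | zero => intro _; rw [h0]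
  | succ i ih =>
    intro hi
    rw [← ih (by omega)]
    exact (hs i (by omega)).1.symm
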